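/- arXiv:2602.16572 — 2 statements merged into one kernel-verified Lean document; each statement's English description precedes it below -/
import Mathlib

section
/- Let R be a commutative unital ring and let A be a unital R-algebra which is a tensor factor of a locally matrix R-algebra, meaning there exists a unital R-algebra A' such that A ⊗_R A' is a locally matrix R-algebra. Let C be a unital R-algebra and let B be a unital R-subalgebra of A ⊗_R C with A ⊗ 1 ⊆ B. Assume that the natural map B → A' ⊗_R B, b ↦ 1 ⊗ b, is injective. Define D := { c ∈ C : 1 ⊗ c ∈ B }. Then D is a unital R-subalgebra of C and B is exactly the subalgebra of A ⊗_R C generated by A ⊗ 1 and 1 ⊗ D; equivalently B = A ⊗_R D. -/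
open scoped TensorProduct

set_option synthInstance.maxHeartbeats 1000000
set_option maxHeartbeats 1000000

/-- A directed union of subalgebras, each having `R` as a direct summand via `1`, contains `R` as a
pure submodule. -/
theorem one_tmul_injective_of_directed {R L N ι : Type*} [CommRing R] [Ring L] [Algebra R L]
    [AddCommGroup N] [Module R N] {S : ι → Subalgebra R L} (hdir : Directed (· ≤ ·) S)
    (hunion : (⋃ i, (S i : Set L)) = Set.univ)
    (hret : ∀ i, ∃ φ : S i →ₗ[R] R, φ 1 = 1) :
    Function.Injective (fun n : N => (1 : L) ⊗ₜ[R] n) := by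
  classical
  refine (injective_iff_map_eq_zero (TensorProduct.mk R L N 1)).2 fun n hn => ?_
  have hcover (x : L) : ∃ i, x ∈ S i := by
    simpa using hunion.symm.subset (Set.mem_univ x)
  have : Nonempty ι := ⟨(hcover 1).choose⟩
  have h1 : (1 : L) ∈ Submodule.span R {(1 : L)} := Submodule.mem_span_singleton_self 1
  obtain ⟨Q, hPQ, hQ, h0⟩ := TensorProduct.eq_zero_of_fg_of_subtype_eq_zero
    (P := Submodule.span R {(1 : L)}) (Submodule.fg_span_singleton 1)
    (t := (⟨1, h1⟩ : Submodule.span R {(1 : L)}) ⊗ₜ[R] n) (by simpa using hn)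
  obtain ⟨s, rfl⟩ := hQ
  choose k hk using hcover
  obtain ⟨i, hi⟩ := hdir.finset_le (s.image k)
  have hle : Submodule.span R (s : Set L) ≤ (S i).toSubmodule :=
    Submodule.span_le.2 fun x hx => hi (k x) (Finset.mem_image_of_mem k hx) (hk x)
  obtain ⟨φ, hφ⟩ := hret i
  let ψ : Submodule.span R (s : Set L) →ₗ[R] R := φ ∘ₗ Submodule.inclusion hle
  have hψ : ψ (Submodule.inclusion hPQ ⟨1, h1⟩) = 1 := hφ
  have h2 := congrArg (fun x => TensorProduct.lid R N (ψ.rTensor N x)) h0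
  simpa only [LinearMap.rTensor_tmul, TensorProduct.lid_tmul, hψ, one_smul, map_zero] using h2

/-- Purity of `R` in `A ⊗ A'` passes to the factor `A'`. -/
theorem one_tmul_injective_of_tensor {R A A' N : Type*} [CommRing R] [Ring A] [Algebra R A]
    [Ring A'] [Algebra R A'] [AddCommGroup N] [Module R N]
    (h : Function.Injective (fun n : N => (1 : A ⊗[R] A') ⊗ₜ[R] n)) :
    Function.Injective (fun n : N => (1 : A') ⊗ₜ[R] n) := by
  intro m n hmn
  apply h
  simpa [Algebra.TensorProduct.one_def] using
    congrArg (fun x => (TensorProduct.assoc R A A' N).symm ((1 : A) ⊗ₜ[R] x)) hmn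

/-- Descent of membership in a submodule along a pure base extension. -/
theorem mem_of_one_tmul_mem_range_lTensor {R A' V : Type*} [CommRing R] [Ring A'] [Algebra R A']
    [AddCommGroup V] [Module R V] {S : Submodule R V}
    (h : Function.Injective (fun n : V ⧸ S => (1 : A') ⊗ₜ[R] n)) {v : V}
    (hv : (1 : A') ⊗ₜ[R] v ∈ LinearMap.range (S.subtype.lTensor A')) : v ∈ S := by
  rw [← Submodule.Quotient.mk_eq_zero]
  apply h
  have hexact := lTensor_exact A' (LinearMap.exact_subtype_mkQ S) S.mkQ_surjective
  simpa using (hexact ((1 : A') ⊗ₜ[R] v)).2 hv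

/-- Matrix units span the matrix algebra, and sandwiching by them extracts coordinates. -/
theorem exists_matrix_units {R L : Type*} [CommRing R] [Ring L] [Algebra R L]
    {S : Subalgebra R L} {n : ℕ} (f : S ≃ₐ[R] Matrix (Fin n) (Fin n) R) :
    ∃ (E : Fin n → Fin n → L) (coord : Fin n → Fin n → L → R),
      ∀ x ∈ S, (x = ∑ p, ∑ q, coord p q x • E p q) ∧
        ∀ p q, ∑ i, E i p * x * E q i = algebraMap R L (coord p q x) := by
  classical
  let g : Matrix (Fin n) (Fin n) R →ₐ[R] L := S.val.comp f.symm
  refine ⟨fun p q => g (Matrix.single p q 1),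
    fun p q x => if h : x ∈ S then f ⟨x, h⟩ p q else 0, fun x hx => ?_⟩
  have hgx : g (f ⟨x, hx⟩) = x := by simp [g]
  simp only [dif_pos hx]
  generalize f ⟨x, hx⟩ = X at hgx
  subst hgx
  refine ⟨?_, fun p q => ?_⟩
  · simp only [← map_smul, ← map_sum]
    congr 1
    simpa using Matrix.matrix_eq_sum_single X
  · simp only [← map_mul, ← map_sum, ← g.commutes, Matrix.single_mul_mul_single, one_mul, mul_one]
    congr 1
    ext i j
    simp [Matrix.sum_apply, Matrix.single_apply, Matrix.algebraMap_matrix_apply, ite_and]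

/-- The coefficient descent: the subalgebra `B ⊇ A ⊗ 1` lies in the span of the pure tensors
`a ⊗ d` with `1 ⊗ d ∈ B`. -/
theorem mem_span_of_directed_matrix {R A A' C ι : Type*} [CommRing R] [Ring A] [Algebra R A]
    [Ring A'] [Algebra R A'] [Ring C] [Algebra R C] {S : ι → Subalgebra R (A ⊗[R] A')}
    (hdir : Directed (· ≤ ·) S)
    (hiso : ∀ i, ∃ n : ℕ, n ≠ 0 ∧ Nonempty (S i ≃ₐ[R] Matrix (Fin n) (Fin n) R))
    (hunion : (⋃ i, (S i : Set (A ⊗[R] A'))) = Set.univ)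
    {B : Subalgebra R (A ⊗[R] C)} (hB : ∀ a : A, a ⊗ₜ[R] (1 : C) ∈ B)
    {b : A ⊗[R] C} (hb : b ∈ B) :
    b ∈ Submodule.span R
      {x : A ⊗[R] C | ∃ (a : A) (d : C), (1 : A) ⊗ₜ[R] d ∈ B ∧ x = a ⊗ₜ[R] d} := by
  classical
  have hret (i : ι) : ∃ φ : S i →ₗ[R] R, φ 1 = 1 := by
    obtain ⟨n, hn, ⟨f⟩⟩ := hiso i
    let z : Fin n := ⟨0, Nat.pos_of_ne_zero hn⟩
    exact ⟨Matrix.entryLinearMap R R z z ∘ₗ f.toLinearMap, by simp⟩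
  have descent {T : Submodule R (A ⊗[R] C)} {v : A ⊗[R] C}
      (hv : (1 : A') ⊗ₜ[R] v ∈ LinearMap.range (T.subtype.lTensor A')) : v ∈ T :=
    mem_of_one_tmul_mem_range_lTensor
      (one_tmul_injective_of_tensor (one_tmul_injective_of_directed hdir hunion hret)) hv
  have hcover (x : A ⊗[R] A') : ∃ i, x ∈ S i := by
    simpa using hunion.symm.subset (Set.mem_univ x)
  choose k hk using hcover
  have : Nonempty ι := ⟨k 1⟩
  let j : A ⊗[R] A' →ₐ[R] A' ⊗[R] (A ⊗[R] C) :=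
    (Algebra.TensorProduct.map (AlgHom.id R A') Algebra.TensorProduct.includeLeft).comp
      (Algebra.TensorProduct.comm R A A').toAlgHom
  let c : C →ₐ[R] A' ⊗[R] (A ⊗[R] C) :=
    Algebra.TensorProduct.includeRight.comp Algebra.TensorProduct.includeRight
  have hj (a : A) (a' : A') : j (a ⊗ₜ a') = a' ⊗ₜ (a ⊗ₜ 1) := by simp [j]
  have hc (d : C) : c d = 1 ⊗ₜ (1 ⊗ₜ d) := rfl
  have hcomm (l : A ⊗[R] A') (d : C) : c d * j l = j l * c d := by
    induction l with
    | zero => simp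
    | tmul a a' => simp [hj, hc]
    | add x y hx hy => simp [mul_add, add_mul, hx, hy]
  obtain ⟨s, hs⟩ := TensorProduct.exists_finset b
  obtain ⟨i, hi⟩ := hdir.finset_le (s.image fun y => k (y.1 ⊗ₜ 1))
  have hmem : ∀ y ∈ s, y.1 ⊗ₜ[R] (1 : A') ∈ S i := fun y hy =>
    hi _ (Finset.mem_image_of_mem _ hy) (hk _)
  obtain ⟨n, -, ⟨f⟩⟩ := hiso i
  obtain ⟨E, coord, hE⟩ := exists_matrix_units f
  let d (p q : Fin n) : C := ∑ y ∈ s, coord p q (y.1 ⊗ₜ 1) • y.2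
  have hb1 : (1 : A') ⊗ₜ[R] b = ∑ y ∈ s, j (y.1 ⊗ₜ 1) * c y.2 := by
    rw [hs, TensorProduct.tmul_sum]
    exact Finset.sum_congr rfl fun y _ => by simp [hj, hc]
  have hb2 : (1 : A') ⊗ₜ[R] b = ∑ p, ∑ q, j (E p q) * c (d p q) := by
    have hy : ∀ y ∈ s, j (y.1 ⊗ₜ 1) * c y.2 =
        ∑ p, ∑ q, coord p q (y.1 ⊗ₜ 1) • (j (E p q) * c y.2) := fun y hy => by
      conv_lhs => rw [(hE _ (hmem y hy)).1]
      simp only [map_sum, map_smul, Finset.sum_mul]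
      exact Finset.sum_congr rfl fun p _ => Finset.sum_congr rfl fun q _ => smul_mul_assoc _ _ _
    rw [hb1, Finset.sum_congr rfl hy, Finset.sum_comm]
    refine Finset.sum_congr rfl fun p _ => ?_
    rw [Finset.sum_comm]
    refine Finset.sum_congr rfl fun q _ => ?_
    simp only [d, map_sum, map_smul, Finset.mul_sum]
    exact Finset.sum_congr rfl fun y _ => (mul_smul_comm _ _ _).symm
  have hd (p q : Fin n) : c (d p q) = ∑ r, j (E r p) * (1 ⊗ₜ b) * j (E q r) := by
    simp only [hb1, Finset.mul_sum, Finset.sum_mul]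
    rw [Finset.sum_comm]
    simp only [d, map_sum, map_smul]
    refine Finset.sum_congr rfl fun y hy => ?_
    have := congrArg (fun l => j l * c y.2) ((hE _ (hmem y hy)).2 p q)
    simp only [map_sum, map_mul, Finset.sum_mul, AlgHom.commutes, ← Algebra.smul_def] at this
    rw [← this]
    exact Finset.sum_congr rfl fun r _ => by simp only [mul_assoc, hcomm]
  let B' := (Algebra.TensorProduct.map (AlgHom.id R A') B.val).range
  have hjB (l : A ⊗[R] A') : j l ∈ B' := by
    induction l with
    | zero => simp
    | tmul a a' => exact ⟨a' ⊗ₜ ⟨_, hB a⟩, by simp [hj]⟩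
    | add x y hx hy => rw [map_add]; exact add_mem hx hy
  have hdB (p q : Fin n) : (1 : A) ⊗ₜ[R] d p q ∈ B := by
    have hcd : c (d p q) ∈ B' := by
      rw [hd]
      exact sum_mem fun r _ => mul_mem (mul_mem (hjB _) ⟨1 ⊗ₜ ⟨b, hb⟩, by simp⟩) (hjB _)
    exact descent (T := B.toSubmodule) hcd
  refine descent ?_
  rw [hb2]
  refine sum_mem fun p _ => sum_mem fun q _ => ?_
  induction E p q with
  | zero => simp
  | tmul a a' =>
    exact ⟨a' ⊗ₜ ⟨a ⊗ₜ d p q, Submodule.subset_span ⟨a, _, hdB p q, rfl⟩⟩, by simp [hj, hc]⟩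
  | add x y hx hy => rw [map_add, add_mul]; exact add_mem hx hy

/-- Let `R` be a commutative unital ring and `A` a unital `R`-algebra
which is a tensor factor of a locally matrix `R`-algebra: there is a unital `R`-algebra
`A'` such that `A ⊗[R] A'` is locally matrix (witnessed by a directed family `(Afam i)`
of unital `R`-subalgebras, each isomorphic to a full matrix algebra over `R`, with union
everything).  Let `C` be a unital `R`-algebra and `B` a unital `R`-subalgebra of
`A ⊗[R] C` with `A ⊗ 1 ⊆ B`, and assume the natural map `B → A' ⊗[R] B`, `b ↦ 1 ⊗ b`,
is injective.  With `D := {c : C | 1 ⊗ c ∈ B}`, the set `D` is a unital `R`-subalgebra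
of `C` and `B` is exactly the subalgebra generated by `A ⊗ 1` and `1 ⊗ D`; equivalently
`B = A ⊗[R] D`, i.e. every element of `B` is a finite sum of elements `a ⊗ d` with
`a ∈ A`, `d ∈ D`. -/
theorem stmt2 (R : Type*) [CommRing R]
    (A : Type*) [Ring A] [Algebra R A]
    (A' : Type*) [Ring A'] [Algebra R A']
    (ι : Type*) (Afam : ι → Subalgebra R (A ⊗[R] A'))
    (hdir : Directed (· ≤ ·) Afam)
    (hiso : ∀ i : ι, ∃ n : ℕ, Nonempty (Afam i ≃ₐ[R] Matrix (Fin n) (Fin n) R))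
    (hunion : (⋃ i : ι, (Afam i : Set (A ⊗[R] A'))) = Set.univ)
    (C : Type*) [Ring C] [Algebra R C]
    (B : Subalgebra R (A ⊗[R] C))
    (hB : ∀ a : A, a ⊗ₜ[R] (1 : C) ∈ B)
    (hinj : Function.Injective (fun b : B => (1 : A') ⊗ₜ[R] b : B → A' ⊗[R] B)) :
    (∃ D : Subalgebra R C, (D : Set C) = {c : C | (1 : A) ⊗ₜ[R] c ∈ B}) ∧
    B = Algebra.adjoin R
        ({x : A ⊗[R] C | ∃ a : A, x = a ⊗ₜ[R] (1 : C)} ∪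
         {x : A ⊗[R] C | ∃ d : C, (1 : A) ⊗ₜ[R] d ∈ B ∧ x = (1 : A) ⊗ₜ[R] d}) ∧
    (B : Set (A ⊗[R] C)) =
      (Submodule.span R
        {x : A ⊗[R] C | ∃ (a : A) (d : C), (1 : A) ⊗ₜ[R] d ∈ B ∧ x = a ⊗ₜ[R] d} :
        Set (A ⊗[R] C)) := by
  have hmul {a : A} {d : C} : a ⊗ₜ[R] d = a ⊗ₜ[R] (1 : C) * (1 : A) ⊗ₜ[R] d := by simp
  have hspan (b : A ⊗[R] C) (hb : b ∈ B) : b ∈ Submodule.span R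
      {x : A ⊗[R] C | ∃ (a : A) (d : C), (1 : A) ⊗ₜ[R] d ∈ B ∧ x = a ⊗ₜ[R] d} := by
    by_cases h : ∃ i, Nonempty (Afam i ≃ₐ[R] Matrix (Fin 0) (Fin 0) R)
    · obtain ⟨i, ⟨f⟩⟩ := h
      have h01 : (0 : A ⊗[R] A') = 1 :=
        congrArg Subtype.val (f.injective (Subsingleton.elim _ _) : (0 : Afam i) = 1)
      let u : A →ₐ[R] B := (Algebra.TensorProduct.includeLeft : A →ₐ[R] A ⊗[R] C).codRestrict B hB
      let g : A ⊗[R] A' →ₐ[R] A' ⊗[R] B :=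
        (Algebra.TensorProduct.map (AlgHom.id R A') u).comp
          (Algebra.TensorProduct.comm R A A').toAlgHom
      have h01' : (0 : A' ⊗[R] B) = 1 := by simpa using congrArg g h01
      have hB01 : (0 : B) = 1 := hinj (by simpa [Algebra.TensorProduct.one_def] using h01')
      have : b = 0 := eq_zero_of_zero_eq_one (congrArg Subtype.val hB01) b
      exact this ▸ zero_mem _
    · refine mem_span_of_directed_matrix hdir (fun i => ?_) hunion hB hb
      obtain ⟨n, hn⟩ := hiso i
      exact ⟨n, fun h0 => h ⟨i, h0 ▸ hn⟩, hn⟩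
  refine ⟨⟨B.comap Algebra.TensorProduct.includeRight, rfl⟩, le_antisymm (fun b hb => ?_) ?_,
    Set.Subset.antisymm hspan ?_⟩
  · refine (Submodule.span_le (p := Subalgebra.toSubmodule (Algebra.adjoin R _))).2 ?_ (hspan b hb)
    rintro _ ⟨a, d, hd, rfl⟩
    rw [hmul]
    exact (Algebra.adjoin R _).mul_mem (Algebra.subset_adjoin (Or.inl ⟨a, rfl⟩))
      (Algebra.subset_adjoin (Or.inr ⟨d, hd, rfl⟩))
  · refine Algebra.adjoin_le ?_
    rintro _ (⟨a, rfl⟩ | ⟨d, hd, rfl⟩)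
    exacts [hB a, hd]
  · refine (Submodule.span_le (p := Subalgebra.toSubmodule B)).2 ?_
    rintro _ ⟨a, d, hd, rfl⟩
    rw [hmul]
    exact B.mul_mem (hB a) hd
end

section
/- Let R be a commutative unital ring and let C be a locally matrix R-algebra. Let B and B' be unital R-subalgebras of C that commute elementwise (bb' = b'b for all b ∈ B, b' ∈ B'), suppose both B and B' are faithfully flat as R-modules, and suppose the multiplication map B ⊗_R B' → C, b ⊗ b' ↦ bb', is bijective. Let A be a unital R-subalgebra of C with B ⊆ A ⊆ C. Then the multiplication map B ⊗_R (A ∩ B') → C, b ⊗ x ↦ bx, is injective and its image is exactly A; in other words, A = B ⊗_R (A ∩ B'). -/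
open scoped TensorProduct

set_option synthInstance.maxHeartbeats 1000000
set_option maxHeartbeats 1000000

/-- The relations of a system of matrix units. -/
structure IsMatrixUnits {C : Type*} [Ring C] {n : ℕ} (e : Fin n → Fin n → C) : Prop where
  mul_mul (k p i j q l : Fin n) :
    e k p * e i j * e q l = if p = i ∧ j = q then e k l else 0
  sum_diag : ∑ k, e k k = 1

/-- If `x = ∑ φ (e i j) * ψ (w i j)` with `φ` and `ψ` commuting, the coefficients `ψ (w p q)` are
recovered from `x` by multiplying with matrix units on both sides. -/
theorem IsMatrixUnits.coeff_eq {C D V F : Type*} [Ring C] [Ring D] [FunLike F C D]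
    [RingHomClass F C D] {n : ℕ} {e : Fin n → Fin n → C} (he : IsMatrixUnits e) (φ : F)
    (ψ : V → D) (hφψ : ∀ c v, Commute (φ c) (ψ v)) (w : Fin n → Fin n → V) (p q : Fin n) :
    ∑ k, φ (e k p) * (∑ i, ∑ j, φ (e i j) * ψ (w i j)) * φ (e q k) = ψ (w p q) := by
  have key (k i j : Fin n) : φ (e k p) * (φ (e i j) * ψ (w i j)) * φ (e q k) =
      if p = i ∧ j = q then φ (e k k) * ψ (w i j) else 0 := by
    rw [mul_assoc, mul_assoc, ← (hφψ (e q k) (w i j)).eq, ← mul_assoc, ← mul_assoc, ← map_mul,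
      ← map_mul, he.mul_mul]
    split_ifs <;> simp
  simp only [Finset.mul_sum, Finset.sum_mul, key, ite_and, Finset.sum_ite_eq,
    Finset.sum_ite_eq', Finset.mem_univ, if_true, Finset.sum_ite_irrel, Finset.sum_const_zero]
  rw [← Finset.sum_mul, ← map_sum, he.sum_diag, map_one, one_mul]

theorem exists_eq_sum_single_tmul {R V : Type*} [CommRing R] [AddCommGroup V] [Module R V] {n : ℕ}
    (t : Matrix (Fin n) (Fin n) R ⊗[R] V) :
    ∃ w : Fin n → Fin n → V, t = ∑ i, ∑ j, Matrix.single i j (1 : R) ⊗ₜ[R] w i j := by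
  induction t with
  | zero => exact ⟨0, by simp⟩
  | tmul m v =>
    refine ⟨fun i j => m i j • v, ?_⟩
    conv_lhs => rw [Matrix.matrix_eq_sum_single m]
    simp only [TensorProduct.sum_tmul, ← TensorProduct.smul_tmul, Matrix.smul_single, smul_eq_mul,
      mul_one]
  | add x y hx hy =>
    obtain ⟨w, rfl⟩ := hx
    obtain ⟨w', rfl⟩ := hy
    exact ⟨w + w', by simp [TensorProduct.tmul_add, Finset.sum_add_distrib]⟩

theorem isMatrixUnits_of_algHom {R C : Type*} [CommRing R] [Ring C] [Algebra R C] {n : ℕ}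
    (f : Matrix (Fin n) (Fin n) R →ₐ[R] C) :
    IsMatrixUnits fun i j => f (Matrix.single i j 1) where
  mul_mul k p i j q l := by
    rw [← map_mul, ← map_mul, Matrix.single_mul_mul_single]
    by_cases h : p = i ∧ j = q
    · obtain ⟨rfl, rfl⟩ := h
      simp
    · have h' : ¬ (i = p ∧ j = q) := fun h' => h ⟨h'.1.symm, h'.2⟩
      simp [h, h']
  sum_diag := by
    rw [← map_sum, ← map_one f]
    congr 1
    ext i j
    simp [Matrix.sum_apply, Matrix.single_apply, Matrix.one_apply, ite_and]

theorem exists_mem_range_rTensor_of_directed {R C V ι : Type*} [CommRing R] [Ring C] [Algebra R C]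
    [AddCommGroup V] [Module R V] (Cfam : ι → Subalgebra R C) (hdir : Directed (· ≤ ·) Cfam)
    (hunion : (⋃ i : ι, (Cfam i : Set C)) = Set.univ) (t : C ⊗[R] V) :
    ∃ i, t ∈ LinearMap.range ((Cfam i).val.toLinearMap.rTensor V) := by
  have hmem (c : C) : ∃ i, c ∈ Cfam i := by
    simpa using hunion.symm.subset (Set.mem_univ c)
  have hmono {i j : ι} (hij : Cfam i ≤ Cfam j) :
      LinearMap.range ((Cfam i).val.toLinearMap.rTensor V) ≤
        LinearMap.range ((Cfam j).val.toLinearMap.rTensor V) := by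
    rintro _ ⟨s, rfl⟩
    refine ⟨(Subalgebra.inclusion hij).toLinearMap.rTensor V s, ?_⟩
    rw [← LinearMap.rTensor_comp_apply]
    rfl
  induction t with
  | zero =>
    obtain ⟨i, -⟩ := hmem 0
    exact ⟨i, zero_mem _⟩
  | tmul c v =>
    obtain ⟨i, hi⟩ := hmem c
    exact ⟨i, (⟨c, hi⟩ : Cfam i) ⊗ₜ v, rfl⟩
  | add x y hx hy =>
    obtain ⟨i, hi⟩ := hx
    obtain ⟨j, hj⟩ := hy
    obtain ⟨k, hik, hjk⟩ := hdir i j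
    exact ⟨k, add_mem (hmono hik hi) (hmono hjk hj)⟩

theorem exists_isMatrixUnits_eq_sum_tmul {R C V ι : Type*} [CommRing R] [Ring C] [Algebra R C]
    [AddCommGroup V] [Module R V] (Cfam : ι → Subalgebra R C) (hdir : Directed (· ≤ ·) Cfam)
    (hiso : ∀ i : ι, ∃ n : ℕ, Nonempty (Cfam i ≃ₐ[R] Matrix (Fin n) (Fin n) R))
    (hunion : (⋃ i : ι, (Cfam i : Set C)) = Set.univ) (t : C ⊗[R] V) :
    ∃ (n : ℕ) (e : Fin n → Fin n → C) (w : Fin n → Fin n → V),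
      IsMatrixUnits e ∧ t = ∑ i, ∑ j, e i j ⊗ₜ[R] w i j := by
  obtain ⟨i, s, rfl⟩ := exists_mem_range_rTensor_of_directed Cfam hdir hunion t
  obtain ⟨n, ⟨g⟩⟩ := hiso i
  obtain ⟨w, hw⟩ := exists_eq_sum_single_tmul (g.toLinearMap.rTensor V s)
  refine ⟨n, _, w, isMatrixUnits_of_algHom ((Cfam i).val.comp g.symm.toAlgHom), ?_⟩
  have hs : s = g.symm.toLinearMap.rTensor V (g.toLinearMap.rTensor V s) := by
    rw [← LinearMap.rTensor_comp_apply]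
    have : g.symm.toLinearMap ∘ₗ g.toLinearMap = LinearMap.id := by ext; simp
    rw [this, LinearMap.rTensor_id_apply]
  rw [hs, hw]
  simp

/-- A faithfully flat algebra is universally injective over the base ring. -/
theorem Module.FaithfullyFlat.mem_of_tmul_one_mem_range {R M S : Type*} [CommRing R]
    [AddCommGroup M] [Module R M] [Ring S] [Algebra R S] [Module.FaithfullyFlat R S]
    (P : Submodule R M) {x : M}
    (hx : x ⊗ₜ[R] (1 : S) ∈ LinearMap.range (P.subtype.rTensor S)) : x ∈ P := by
  rw [← rTensor_mkQ, LinearMap.mem_ker, LinearMap.rTensor_tmul] at hx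
  rw [← Submodule.Quotient.mk_eq_zero, ← Submodule.mkQ_apply,
    ← Module.FaithfullyFlat.one_tmul_eq_zero_iff R _ (A := S)]
  simpa using congrArg (TensorProduct.comm R _ S) hx

/-- Let `R` be a commutative unital ring and `C` a locally matrix
`R`-algebra (witnessed by a directed family `(Cfam i)` of unital `R`-subalgebras, each
isomorphic to a full matrix algebra over `R`, with union all of `C`).  Let `B`, `B'` be
unital `R`-subalgebras of `C` that commute elementwise, both faithfully flat as
`R`-modules, and such that the multiplication map `B ⊗[R] B' → C`, `b ⊗ b' ↦ b * b'`,
is bijective.  Let `A` be a unital `R`-subalgebra of `C` with `B ⊆ A`.  Then the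
multiplication map `B ⊗[R] (A ⊓ B') → C` is injective and its range is exactly `A`. -/
theorem stmt4 (R : Type*) [CommRing R]
    (C : Type*) [Ring C] [Algebra R C]
    (ι : Type*) (Cfam : ι → Subalgebra R C)
    (hdir : Directed (· ≤ ·) Cfam)
    (hiso : ∀ i : ι, ∃ n : ℕ, Nonempty (Cfam i ≃ₐ[R] Matrix (Fin n) (Fin n) R))
    (hunion : (⋃ i : ι, (Cfam i : Set C)) = Set.univ)
    (B B' : Subalgebra R C)
    (hcomm : ∀ b ∈ B, ∀ b' ∈ B', b * b' = b' * b)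
    [Module.FaithfullyFlat R B] [Module.FaithfullyFlat R B']
    (hbij : Function.Bijective
      (Algebra.TensorProduct.lift B.val B'.val
        (fun b b' => hcomm b b.2 b' b'.2)))
    (A : Subalgebra R C) (hBA : B ≤ A) :
    Function.Injective
      (Algebra.TensorProduct.lift B.val (A ⊓ B').val
        (fun b x => hcomm b b.2 x x.2.2)) ∧
    Set.range
      (Algebra.TensorProduct.lift B.val (A ⊓ B').val
        (fun b x => hcomm b b.2 x x.2.2)) = (A : Set C) := by
  set μ := Algebra.TensorProduct.lift B.val B'.val (fun b b' => hcomm b b.2 b' b'.2)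
  have hμ (b : B) (v : B') : μ (b ⊗ₜ v) = b * v := rfl
  set ν := Algebra.TensorProduct.lift B.val (A ⊓ B').val (fun b x => hcomm b b.2 x x.2.2)
  have hinf : A ⊓ B' ≤ B' := inf_le_right
  refine ⟨?_, Set.Subset.antisymm ?_ fun a ha => ?_⟩
  · have hinc : Function.Injective
        ((Subalgebra.inclusion hinf).toLinearMap.lTensor B) :=
      Module.Flat.lTensor_preserves_injective_linearMap _ (Subalgebra.inclusion_injective hinf)
    have hcomp : ν.toLinearMap = μ.toLinearMap ∘ₗ
        (Subalgebra.inclusion hinf).toLinearMap.lTensor B :=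
      TensorProduct.ext' fun _ _ => rfl
    intro x y hxy
    exact hbij.1.comp hinc <| (LinearMap.congr_fun hcomp x).symm.trans (Eq.trans hxy (LinearMap.congr_fun hcomp y))
  · rintro _ ⟨t, rfl⟩
    induction t with
    | zero => simp
    | tmul b x => exact mul_mem (hBA b.2) x.2.1
    | add x y hx hy => rw [map_add]; exact add_mem hx hy
  · let φ : C →ₐ[R] C ⊗[R] B' :=
      (Algebra.TensorProduct.map B.val (AlgHom.id R B')).comp
        (AlgEquiv.ofBijective μ hbij).symm.toAlgHom
    have hφμ (s : B ⊗[R] B') : φ (μ s) = Algebra.TensorProduct.map B.val (AlgHom.id R B') s :=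
      congrArg (Algebra.TensorProduct.map B.val (AlgHom.id R B'))
        ((AlgEquiv.ofBijective μ hbij).symm_apply_apply s)
    have hφB (b : B) : φ b = (b : C) ⊗ₜ 1 := by
      simpa [hμ] using hφμ (b ⊗ₜ 1)
    let ψ : B' →ₗ[R] C ⊗[R] B' := (TensorProduct.mk R C B').flip 1 ∘ₗ B'.val.toLinearMap
    have hφψ (c : C) (v : B') : Commute (φ c) (ψ v) := by
      obtain ⟨s, rfl⟩ := hbij.2 c
      rw [hφμ]
      induction s with
      | zero => simp
      | tmul b b' => simp [ψ, Commute, SemiconjBy, hcomm b b.2 v v.2]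
      | add x y hx hy => rw [map_add]; exact hx.add_left hy
    let Ψ : C ⊗[R] B' →ₗ[R] C ⊗[R] B' :=
      TensorProduct.lift ((LinearMap.mul R (C ⊗[R] B')).compl₁₂ φ.toLinearMap ψ)
    have hΨ (s : B ⊗[R] B') : Ψ (B.val.toLinearMap.rTensor B' s) = μ s ⊗ₜ 1 := by
      induction s with
      | zero => simp
      | tmul b v => simp [Ψ, ψ, hφB, hμ]
      | add x y hx hy => simp only [map_add, hx, hy, TensorProduct.add_tmul]
    obtain ⟨s, hs⟩ := hbij.2 a
    obtain ⟨n, e, w, he, hew⟩ := exists_isMatrixUnits_eq_sum_tmul Cfam hdir hiso hunion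
      (B.val.toLinearMap.rTensor B' s)
    have hsum : a ⊗ₜ[R] (1 : B') = ∑ i, ∑ j, φ (e i j) * ψ (w i j) := by
      rw [← hs, ← hΨ, hew]
      simp [Ψ]
    have hwA (p q : Fin n) : (w p q : C) ∈ A := by
      let S := (Algebra.TensorProduct.map A.val (AlgHom.id R B')).range
      have hφS (c : C) : φ c ∈ S := by
        obtain ⟨s, rfl⟩ := hbij.2 c
        rw [hφμ]
        refine ⟨Algebra.TensorProduct.map (Subalgebra.inclusion hBA) (AlgHom.id R B') s, ?_⟩
        induction s with
        | zero => simp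
        | tmul b b' => rfl
        | add x y hx hy => simp only [map_add] at hx hy ⊢; rw [hx, hy]
      have haS : a ⊗ₜ[R] (1 : B') ∈ S := ⟨(⟨a, ha⟩ : A) ⊗ₜ 1, rfl⟩
      have hwS : ψ (w p q) ∈ S := by
        rw [← he.coeff_eq φ ψ hφψ w p q, ← hsum]
        exact sum_mem fun k _ => mul_mem (mul_mem (hφS _) haS) (hφS _)
      exact Module.FaithfullyFlat.mem_of_tmul_one_mem_range (S := B')
        (Subalgebra.toSubmodule A) hwS
    have haP : a ∈ LinearMap.range ν.toLinearMap := by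
      refine Module.FaithfullyFlat.mem_of_tmul_one_mem_range (S := B') _ ?_
      rw [hsum]
      refine sum_mem fun i _ => sum_mem fun j _ => ?_
      obtain ⟨s, hs⟩ := hbij.2 (e i j)
      rw [← hs, hφμ]
      clear hs
      induction s with
      | zero => simp
      | tmul b b' =>
        refine ⟨(⟨b * w i j, b ⊗ₜ ⟨w i j, hwA i j, (w i j).2⟩, rfl⟩ :
          LinearMap.range ν.toLinearMap) ⊗ₜ b', ?_⟩
        simp [ψ]
      | add x y hx hy => rw [map_add, add_mul]; exact add_mem hx hy
    exact haP
end
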